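/- arXiv:1507.03058 — 5 statements merged into one kernel-verified Lean document; each statement's English description precedes it below -/
import Mathlib

section
/- Let A and B be nonempty words over the two-letter alphabet 𝔸 = {a,b} with A·B ≠ B·A. Then every word W that is simultaneously a suffix of some power A^m (m ≥ 1) and a suffix of some power B^k (k ≥ 1) satisfies |W| ≤ |A| + |B| − 2. -/
namespace Subst

/-- `pow A m` is the `m`-fold concatenation `A^m`. -/
def pow (A : List Bool) : ℕ → List Bool
  | 0 => []
  | n + 1 => pow A n ++ A

/-- Membership in the submonoid of `𝔸*` generated by `{A, B}`. -/
inductive GenAB (A B : List Bool) : List Bool → Prop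
  | nil : GenAB A B []
  | appA : ∀ {W}, GenAB A B W → GenAB A B (W ++ A)
  | appB : ∀ {W}, GenAB A B W → GenAB A B (W ++ B)

/-- The extension of a substitution `σ : 𝔸 → 𝔸*` to a monoid morphism of `𝔸*`. -/
def subst (σ : Bool → List Bool) : List Bool → List Bool
  | [] => []
  | c :: w => σ c ++ subst σ w

/-- The factor `ξ[i, i+n)` of the infinite sequence `ξ`. -/
def wordAt (ξ : ℕ → Bool) (i n : ℕ) : List Bool :=
  (List.range n).map fun k => ξ (i + k)

/-- `W` is a factor of the infinite sequence `ξ`. -/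
def IsFactor (ξ : ℕ → Bool) (W : List Bool) : Prop :=
  ∃ i, W = wordAt ξ i W.length

/-- `ξ` is a fixed point of `σ`: for every `n`, `σ(ξ[0,n))` is a prefix of `ξ`. -/
def IsFixedPoint (σ : Bool → List Bool) (ξ : ℕ → Bool) : Prop :=
  ∀ n, subst σ (wordAt ξ 0 n) = wordAt ξ 0 (subst σ (wordAt ξ 0 n)).length

/-- `ξ` is recurrent: every factor occurs at infinitely many positions. -/
def Recurrent (ξ : ℕ → Bool) : Prop :=
  ∀ W, IsFactor ξ W → ∀ N, ∃ i, N ≤ i ∧ W = wordAt ξ i W.length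

/-- `ξ` is ultimately periodic. -/
def UltPeriodic (ξ : ℕ → Bool) : Prop :=
  ∃ p, 1 ≤ p ∧ ∃ N, ∀ n, N ≤ n → ξ (n + p) = ξ n

/-- `σ` is non-erasing: the image of each letter is nonempty. -/
def NonErasing (σ : Bool → List Bool) : Prop := ∀ c, σ c ≠ []

/-- `σ` is well-marked: `σ(c)` begins with the letter `c` for each letter `c`. -/
def WellMarked (σ : Bool → List Bool) : Prop := ∀ c, ∃ t, σ c = c :: t

/-- `σ` is primitive: for some `n ≥ 1`, each letter occurs in `σⁿ(d)` for each letter `d`. -/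
def Primitive (σ : Bool → List Bool) : Prop :=
  ∃ n, 1 ≤ n ∧ ∀ c d : Bool, c ∈ (subst σ)^[n] [d]

/-- `W` is a right special factor of `ξ`: both `Wa` and `Wb` are factors of `ξ`. -/
def RightSpecial (ξ : ℕ → Bool) (W : List Bool) : Prop :=
  ∀ c : Bool, IsFactor ξ (W ++ [c])

/-- `W` is a left special factor of `ξ`: both `aW` and `bW` are factors of `ξ`. -/
def LeftSpecial (ξ : ℕ → Bool) (W : List Bool) : Prop :=
  ∀ c : Bool, IsFactor ξ (c :: W)

/-- A right special factor is strong if all of `aWa, aWb, bWa, bWb` are factors. -/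
def StrongSpecial (ξ : ℕ → Bool) (W : List Bool) : Prop :=
  ∀ c d : Bool, IsFactor ξ (c :: (W ++ [d]))

/-- A right special factor is weak if neither `aW` nor `bW` is right special. -/
def WeakSpecial (ξ : ℕ → Bool) (W : List Bool) : Prop :=
  RightSpecial ξ W ∧ ∀ c : Bool, ¬ RightSpecial ξ (c :: W)

/-- The operator `T(W) = W₀ · σ(W)`. -/
def T (σ : Bool → List Bool) (W0 W : List Bool) : List Bool := W0 ++ subst σ W

/-- Specification of the word `W₀` (the longest common suffix of `A^∞` and `B^∞`)
together with the distinct letters `δ_a, δ_b`:  `δ_c · W₀` is a suffix of some power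
of `σ(c)` for each letter `c`, and `δ_a ≠ δ_b`. -/
def W0Spec (σ : Bool → List Bool) (W0 : List Bool) (δ : Bool → Bool) : Prop :=
  δ false ≠ δ true ∧ ∀ c, ∃ m, 1 ≤ m ∧ (δ c :: W0) <:+ pow (σ c) m

/-- The incidence matrix of `σ`: its columns are the Parikh vectors of `σ(a)` and `σ(b)`. -/
def incMat (σ : Bool → List Bool) : Matrix Bool Bool ℤ :=
  Matrix.of fun c d => ((σ d).count c : ℤ)

end Subst

open Subst

namespace Subst

theorem append_pow_comm (A : List Bool) (n : ℕ) : A ++ pow A n = pow A n ++ A := by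
  induction n with
  | zero => simp [pow]
  | succ n ih => rw [pow, ← List.append_assoc, ih]

theorem reverse_pow (A : List Bool) (n : ℕ) : (pow A n).reverse = pow A.reverse n := by
  induction n with
  | zero => rfl
  | succ n ih => rw [pow, List.reverse_append, ih, append_pow_comm, pow]

theorem prefix_pow (A : List Bool) {n : ℕ} (hn : 1 ≤ n) : A <+: pow A n := by
  obtain ⟨n, rfl⟩ := Nat.exists_eq_add_of_le' hn
  exact ⟨pow A n, append_pow_comm A n⟩

theorem hasPeriod_pow (A : List Bool) {n : ℕ} (hn : 1 ≤ n) :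
    (pow A n).HasPeriod A.length := by
  rw [List.HasPeriod, ← List.prefix_iff_eq_take.mp (prefix_pow A hn), append_pow_comm]
  exact List.prefix_append _ _

end Subst

theorem List.HasPeriod.getElem?_append_of_prefixes {α : Type*} {V X Y : List α} {g : ℕ}
    (hV : V.HasPeriod g) (hX : X <+: V) (hY : Y <+: V) (hgX : g ∣ X.length) {i : ℕ}
    (hi : i < X.length + Y.length) : (X ++ Y)[i]? = V[i % g]? := by
  have prefix_eq {Z : List α} (hZ : Z <+: V) {j : ℕ} (hj : j < Z.length) :
      Z[j]? = V[j % g]? := by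
    rw [hV.getElem?_mod g j V (hj.trans_le hZ.length_le)]
    obtain ⟨t, rfl⟩ := hZ
    rw [List.getElem?_append_left hj]
  rcases lt_or_ge i X.length with h | h
  · rw [List.getElem?_append_left h, prefix_eq hX h]
  · rw [List.getElem?_append_right h, prefix_eq hY (by lia)]
    obtain ⟨c, hc⟩ := hgX
    rw [hc] at h ⊢
    rw [Nat.sub_mul_mod h]

/-- Prefixes of a word with period `g` whose lengths are multiples of `g` commute. -/
theorem List.HasPeriod.append_comm_of_prefixes {α : Type*} {V X Y : List α} {g : ℕ}
    (hV : V.HasPeriod g) (hX : X <+: V) (hY : Y <+: V)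
    (hgX : g ∣ X.length) (hgY : g ∣ Y.length) : X ++ Y = Y ++ X := by
  refine List.ext_getElem? fun i => ?_
  rcases lt_or_ge i (X.length + Y.length) with h | h
  · rw [hV.getElem?_append_of_prefixes hX hY hgX h,
      hV.getElem?_append_of_prefixes hY hX hgY (by lia)]
  · rw [List.getElem?_eq_none (by simpa using h),
      List.getElem?_eq_none (by simpa [add_comm] using h)]

/-- If `A, B` are nonempty words with `A·B ≠ B·A`, then any word `W`
that is a suffix of some `A^m` (`m ≥ 1`) and of some `B^k` (`k ≥ 1`) satisfies
`|W| ≤ |A| + |B| − 2`. -/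
theorem statement0 (A B : List Bool) (hA : A ≠ []) (hB : B ≠ [])
    (hAB : A ++ B ≠ B ++ A) (W : List Bool)
    (m : ℕ) (hm : 1 ≤ m) (hWA : W <:+ pow A m)
    (k : ℕ) (hk : 1 ≤ k) (hWB : W <:+ pow B k) :
    W.length ≤ A.length + B.length - 2 := by
  by_contra! hlt
  have hA' := List.length_pos_iff.mpr hA
  have hB' := List.length_pos_iff.mpr hB
  have hVA : W.reverse <+: pow A.reverse m := by
    rwa [← reverse_pow, List.reverse_prefix]
  have hVB : W.reverse <+: pow B.reverse k := by
    rwa [← reverse_pow, List.reverse_prefix]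
  have hpA := (hasPeriod_pow A.reverse hm).infix hVA.isInfix
  have hpB := (hasPeriod_pow B.reverse hk).infix hVB.isInfix
  have hg := Nat.gcd_pos_of_pos_left B.reverse.length (List.length_reverse (as := A) ▸ hA')
  have hp := hpA.gcd hpB (by simp only [List.length_reverse] at hg ⊢; lia)
  have hXA := List.prefix_of_prefix_length_le (prefix_pow A.reverse hm) hVA
    (by simp only [List.length_reverse]; lia)
  have hXB := List.prefix_of_prefix_length_le (prefix_pow B.reverse hk) hVB
    (by simp only [List.length_reverse]; lia)
  have hcomm := hp.append_comm_of_prefixes hXB hXA (Nat.gcd_dvd_right _ _) (Nat.gcd_dvd_left _ _)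
  exact hAB (List.reverse_injective (by simpa using hcomm))
end

section
/- Let A, B be nonempty words over 𝔸 = {a,b} with A·B ≠ B·A, and let W_0, δ_a, δ_b be as in the context. Then for every word W in the submonoid of 𝔸* generated by {A, B}, the words W and W_0 are suffix-comparable: either W is a suffix of W_0 or W_0 is a suffix of W. -/
namespace Subst

theorem pow_succ_eq_append_pow (A : List Bool) (m : ℕ) : pow A (m + 1) = A ++ pow A m := by
  induction m with
  | zero => simp [pow]
  | succ m ih =>
    rw [pow, ih, List.append_assoc, ← ih]
    rfl

theorem suffix_append_of_suffix_pow {A V : List Bool} {m : ℕ} (h : V <:+ pow A m) :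
    V <:+ V ++ A := by
  have h_short : V <:+ pow A (m + 1) := by
    rw [pow_succ_eq_append_pow]
    exact h.trans (List.suffix_append _ _)
  have h_long : V ++ A <:+ pow A (m + 1) := by
    obtain ⟨t, ht⟩ := h
    exact ⟨t, by rw [pow, ← ht, List.append_assoc]⟩
  exact List.suffix_of_suffix_length_le h_short h_long (by simp)

theorem GenAB.suffix_append {A B V W : List Bool} (hA : V <:+ V ++ A) (hB : V <:+ V ++ B)
    (hW : GenAB A B W) : V <:+ V ++ W := by
  have step {U C : List Bool} (hC : V <:+ V ++ C) (hU : V <:+ V ++ U) :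
      V <:+ V ++ (U ++ C) := by
    obtain ⟨t, ht⟩ := hU
    exact hC.trans ⟨t, by rw [← List.append_assoc, ht, List.append_assoc]⟩
  induction hW with
  | nil => simp
  | appA _ ih => exact step hA ih
  | appB _ ih => exact step hB ih

end Subst

open Subst
/-- Every word `W` in the submonoid generated by `{A, B}` is
suffix-comparable with `W₀`. -/
theorem statement1 (A B : List Bool) (hA : A ≠ []) (hB : B ≠ [])
    (hAB : A ++ B ≠ B ++ A)
    (W0 : List Bool) (δa δb : Bool) (hδ : δa ≠ δb)
    (hδa : ∃ m, 1 ≤ m ∧ (δa :: W0) <:+ pow A m)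
    (hδb : ∃ k, 1 ≤ k ∧ (δb :: W0) <:+ pow B k) :
    ∀ W, GenAB A B W → W <:+ W0 ∨ W0 <:+ W := by
  intro W hW
  obtain ⟨m, -, hm⟩ := hδa
  obtain ⟨k, -, hk⟩ := hδb
  have h_tail (c : Bool) : W0 <:+ c :: W0 := List.suffix_cons c W0
  exact List.suffix_or_suffix_of_suffix (List.suffix_append W0 W)
    (hW.suffix_append (suffix_append_of_suffix_pow ((h_tail δa).trans hm))
      (suffix_append_of_suffix_pow ((h_tail δb).trans hk)))
end

section
/- Let σ be a non-erasing, well-marked substitution over 𝔸 = {a,b} with A = σ(a), B = σ(b), A·B ≠ B·A, and let W_0 be as in the context, T(W) = W_0·σ(W). Then for all words W₁, W₂: (i) T(W₁) = T(W₂) if and only if W₁ = W₂; (ii) T(W₁) is a prefix of T(W₂) if and only if W₁ is a prefix of W₂; (iii) T(W₁) is a suffix of T(W₂) if and only if W₁ is a suffix of W₂. -/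
open Subst
namespace Subst

theorem subst_append (σ : Bool → List Bool) (U V : List Bool) :
    subst σ (U ++ V) = subst σ U ++ subst σ V := by
  induction U with
  | nil => rfl
  | cons c U ih => simp [subst, ih]

theorem T_append (σ : Bool → List Bool) (W0 U V : List Bool) :
    T σ W0 (U ++ V) = T σ W0 U ++ subst σ V := by
  simp [T, subst_append]

theorem T_concat (σ : Bool → List Bool) (W0 W : List Bool) (c : Bool) :
    T σ W0 (W ++ [c]) = T σ W0 W ++ σ c := by
  simp [T_append, subst]

theorem pow_suffix_pow_succ (A : List Bool) (m : ℕ) : pow A m <:+ pow A (m + 1) := by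
  induction m with
  | zero => exact List.nil_suffix
  | succ m ih =>
    obtain ⟨U, hU⟩ := ih
    exact ⟨U, by rw [pow, ← List.append_assoc, hU, ← pow]⟩

theorem W0Spec.cons_suffix {σ : Bool → List Bool} {W0 : List Bool} {δ : Bool → Bool}
    (hW0 : W0Spec σ W0 δ) (hne : NonErasing σ) (c : Bool) :
    (δ c :: W0) <:+ W0 ++ σ c := by
  obtain ⟨m, -, hm⟩ := hW0.2 c
  have hW : W0 ++ σ c <:+ pow (σ c) (m + 1) :=
    List.suffix_append_self_iff.2 ((List.suffix_cons _ _).trans hm)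
  refine List.suffix_of_suffix_length_le (hm.trans (pow_suffix_pow_succ _ m)) hW ?_
  have := List.length_pos_iff.2 (hne c)
  simp only [List.length_cons, List.length_append]
  lia

theorem W0Spec.suffix_T {σ : Bool → List Bool} {W0 : List Bool} {δ : Bool → Bool}
    (hW0 : W0Spec σ W0 δ) (hne : NonErasing σ) (W : List Bool) : W0 <:+ T σ W0 W := by
  induction W using List.reverseRecOn with
  | nil => simp [T, subst]
  | append_singleton W c ih =>
    rw [T_concat]
    exact ((List.suffix_cons _ _).trans (hW0.cons_suffix hne c)).trans
      (List.suffix_append_self_iff.2 ih)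

theorem W0Spec.cons_suffix_T_concat {σ : Bool → List Bool} {W0 : List Bool} {δ : Bool → Bool}
    (hW0 : W0Spec σ W0 δ) (hne : NonErasing σ) (W : List Bool) (c : Bool) :
    (δ c :: W0) <:+ T σ W0 (W ++ [c]) := by
  rw [T_concat]
  exact (hW0.cons_suffix hne c).trans (List.suffix_append_self_iff.2 (hW0.suffix_T hne W))

theorem W0Spec.injective {σ : Bool → List Bool} {W0 : List Bool} {δ : Bool → Bool}
    (hW0 : W0Spec σ W0 δ) : Function.Injective δ := by
  have h := hW0.1
  rintro (_ | _) (_ | _) hcd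
  · rfl
  · exact absurd hcd h
  · exact absurd hcd.symm h
  · rfl

theorem subst_prefix_iff {σ : Bool → List Bool} (hwm : WellMarked σ) (W1 W2 : List Bool) :
    subst σ W1 <+: subst σ W2 ↔ W1 <+: W2 := by
  constructor
  · induction W1 generalizing W2 with
    | nil => exact fun _ => List.nil_prefix
    | cons c W1 ih =>
      intro h
      obtain ⟨s, hs⟩ := hwm c
      cases W2 with
      | nil => simp [subst, hs] at h
      | cons d W2 =>
        obtain ⟨t, ht⟩ := hwm d
        obtain rfl : c = d := by
          simp only [subst, hs, ht, List.cons_append, List.cons_prefix_cons] at h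
          exact h.1
        exact List.cons_prefix_cons.2 ⟨rfl, ih W2 ((List.prefix_append_right_inj _).1 h)⟩
  · rintro ⟨U, rfl⟩
    exact ⟨subst σ U, (subst_append σ W1 U).symm⟩

theorem T_prefix_iff {σ : Bool → List Bool} (hwm : WellMarked σ) (W0 W1 W2 : List Bool) :
    T σ W0 W1 <+: T σ W0 W2 ↔ W1 <+: W2 :=
  (List.prefix_append_right_inj W0).trans (subst_prefix_iff hwm W1 W2)

theorem T_injective {σ : Bool → List Bool} (hwm : WellMarked σ) (W0 : List Bool) :
    Function.Injective (T σ W0) := by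
  intro W1 W2 h
  have h12 := (T_prefix_iff hwm W0 W1 W2).1 (h ▸ List.prefix_rfl)
  have h21 := (T_prefix_iff hwm W0 W2 W1).1 (h ▸ List.prefix_rfl)
  exact h12.eq_of_length_le h21.length_le

theorem W0Spec.T_suffix_iff {σ : Bool → List Bool} {W0 : List Bool} {δ : Bool → Bool}
    (hW0 : W0Spec σ W0 δ) (hne : NonErasing σ) (W1 W2 : List Bool) :
    T σ W0 W1 <:+ T σ W0 W2 ↔ W1 <:+ W2 := by
  constructor
  · induction W1 using List.reverseRecOn generalizing W2 with
    | nil => exact fun _ => List.nil_suffix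
    | append_singleton W1 c ih =>
      intro h
      have hc := (hW0.cons_suffix_T_concat hne W1 c).trans h
      rcases List.eq_nil_or_concat' W2 with rfl | ⟨W2, d, rfl⟩
      · simpa [T, subst] using hc.length_le
      · have hd := hW0.cons_suffix_T_concat hne W2 d
        have hcd := (List.suffix_of_suffix_length_le hc hd (by simp)).eq_of_length (by simp)
        obtain rfl : c = d := hW0.injective (List.cons.inj hcd).1
        rw [T_concat, T_concat] at h
        exact List.suffix_append_self_iff.2 (ih W2 (List.suffix_append_self_iff.1 h))
  · rintro ⟨U, rfl⟩
    rw [T_append]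
    exact List.suffix_append_self_iff.2 (hW0.suffix_T hne U)

end Subst

/-- For a non-erasing well-marked substitution, `T` preserves and
reflects equality, the prefix relation and the suffix relation. -/
theorem statement5 (σ : Bool → List Bool) (hne : NonErasing σ)
    (hwm : WellMarked σ)
    (hAB : σ false ++ σ true ≠ σ true ++ σ false)
    (W0 : List Bool) (δ : Bool → Bool) (hW0 : W0Spec σ W0 δ) :
    ∀ W1 W2 : List Bool,
      (T σ W0 W1 = T σ W0 W2 ↔ W1 = W2) ∧
      (T σ W0 W1 <+: T σ W0 W2 ↔ W1 <+: W2) ∧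
      (T σ W0 W1 <:+ T σ W0 W2 ↔ W1 <:+ W2) := by
  intro W1 W2
  exact ⟨(T_injective hwm W0).eq_iff, T_prefix_iff hwm W0 W1 W2, hW0.T_suffix_iff hne W1 W2⟩
end

section
/- Let ξ : ℕ → 𝔸 be a recurrent infinite sequence over the two-letter alphabet 𝔸 = {a,b}. Then for every n ∈ ℕ, s(n+1) − s(n) = #S²ₙ − #S⁰ₙ (as integers), where s(n) is the number of right special factors of length n, S²ₙ is the set of strong right special factors of length n, and S⁰ₙ is the set of weak right special factors of length n. -/
namespace Subst

theorem IsFactor.of_cons {ξ : ℕ → Bool} {c : Bool} {W : List Bool}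
    (h : IsFactor ξ (c :: W)) : IsFactor ξ W := by
  obtain ⟨i, hi⟩ := h
  refine ⟨i + 1, ?_⟩
  simp only [wordAt, List.length_cons, List.range_succ_eq_map, List.map_cons, List.map_map,
    List.cons.injEq] at hi
  rw [wordAt]
  conv_lhs => rw [hi.2]
  refine List.map_congr_left fun k _ => ?_
  simp only [Function.comp_apply, Nat.succ_eq_add_one]
  congr 1
  omega

theorem RightSpecial.of_cons {ξ : ℕ → Bool} {c : Bool} {W : List Bool}
    (h : RightSpecial ξ (c :: W)) : RightSpecial ξ W :=
  fun d => (h d).of_cons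

/-- A word is strong exactly when both of its left extensions are right special. -/
theorem strongSpecial_iff {ξ : ℕ → Bool} {W : List Bool} :
    StrongSpecial ξ W ↔ ∀ c, RightSpecial ξ (c :: W) :=
  Iff.rfl

end Subst

open Subst
/-- For a recurrent binary sequence `ξ`,
`s(n+1) − s(n) = #S²ₙ − #S⁰ₙ`. -/
theorem statement11 (ξ : ℕ → Bool) (hrec : Recurrent ξ) (n : ℕ) :
    ({W : List Bool | W.length = n + 1 ∧ RightSpecial ξ W}.ncard : ℤ)
      - ({W : List Bool | W.length = n ∧ RightSpecial ξ W}.ncard : ℤ)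
    = ({W : List Bool | W.length = n ∧ RightSpecial ξ W ∧ StrongSpecial ξ W}.ncard : ℤ)
      - ({W : List Bool | W.length = n ∧ WeakSpecial ξ W}.ncard : ℤ) := by
  have hfin (m : ℕ) (p : List Bool → Prop) : {W : List Bool | W.length = m ∧ p W}.Finite :=
    (List.finite_length_eq Bool m).subset fun _ hW => hW.1
  let R (c : Bool) : Set (List Bool) := {W | W.length = n ∧ RightSpecial ξ (c :: W)}
  have hR (c : Bool) : (R c).Finite := hfin n _
  have hsucc : {W : List Bool | W.length = n + 1 ∧ RightSpecial ξ W}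
      = List.cons false '' R false ∪ List.cons true '' R true := by
    ext W
    rcases W with _ | ⟨_ | _, W⟩ <;> simp [R]
  have hdisj : Disjoint (List.cons false '' R false) (List.cons true '' R true) := by
    rw [Set.disjoint_left]
    rintro _ ⟨V, -, rfl⟩ ⟨W, -, h⟩
    simp at h
  have hcard : {W : List Bool | W.length = n + 1 ∧ RightSpecial ξ W}.ncard
      = (R false).ncard + (R true).ncard := by
    rw [hsucc, Set.ncard_union_eq hdisj ((hR _).image _) ((hR _).image _),
      Set.ncard_image_of_injective _ List.cons_injective,
      Set.ncard_image_of_injective _ List.cons_injective]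
  have hinter : R false ∩ R true
      = {W : List Bool | W.length = n ∧ RightSpecial ξ W ∧ StrongSpecial ξ W} := by
    ext W
    simp only [R, Set.mem_inter_iff, Set.mem_ofPred_eq, strongSpecial_iff, Bool.forall_bool]
    exact ⟨fun h => ⟨h.1.1, h.1.2.of_cons, h.1.2, h.2.2⟩,
      fun h => ⟨⟨h.1, h.2.2.1⟩, h.1, h.2.2.2⟩⟩
  have hsplit : {W : List Bool | W.length = n ∧ RightSpecial ξ W}
      = (R false ∪ R true) ∪ {W : List Bool | W.length = n ∧ WeakSpecial ξ W} := by
    ext W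
    simp only [R, Set.mem_union, Set.mem_ofPred_eq, WeakSpecial, Bool.forall_bool]
    have hf := @RightSpecial.of_cons ξ false W
    have ht := @RightSpecial.of_cons ξ true W
    tauto
  have hweak : Disjoint (R false ∪ R true)
      {W : List Bool | W.length = n ∧ WeakSpecial ξ W} := by
    rw [Set.disjoint_left]
    rintro W (h | h) hW
    exacts [hW.2.2 _ h.2, hW.2.2 _ h.2]
  have hs := Set.ncard_union_eq hweak ((hR _).union (hR _)) (hfin n _)
  rw [← hsplit] at hs
  have hie := Set.ncard_union_add_ncard_inter (R false) (R true) (hR _) (hR _)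
  rw [hinter] at hie
  omega
end

section
/- Let ξ : ℕ → 𝔸 be a recurrent infinite sequence over the two-letter alphabet 𝔸 = {a,b}. Then every weak right special factor and every strong right special factor of ξ is both right special and left special; that is, S⁰ₙ ∪ S²ₙ ⊆ Sₙ ∩ LSₙ for every n. -/
open Subst

namespace Subst

variable {ξ : ℕ → Bool} {W : List Bool}

theorem length_wordAt (ξ : ℕ → Bool) (i n : ℕ) : (wordAt ξ i n).length = n := by
  simp [wordAt]

theorem wordAt_succ (ξ : ℕ → Bool) (i n : ℕ) :
    wordAt ξ i (n + 1) = wordAt ξ i n ++ [ξ (i + n)] := by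
  simp [wordAt, List.range_succ]

theorem wordAt_succ_eq_cons (ξ : ℕ → Bool) (i n : ℕ) :
    wordAt ξ i (n + 1) = ξ i :: wordAt ξ (i + 1) n := by
  simp [wordAt, List.range_succ_eq_map, Nat.add_assoc, Nat.add_comm 1]

/-- Deleting the last letter of a factor leaves a factor. -/
theorem IsFactor.of_append_singleton {c : Bool} (h : IsFactor ξ (W ++ [c])) :
    IsFactor ξ W := by
  obtain ⟨i, hi⟩ := h
  rw [List.length_append, List.length_singleton, wordAt_succ] at hi
  exact ⟨i, (List.append_inj hi (length_wordAt ξ i _).symm).1⟩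

/-- Every factor of a recurrent sequence can be extended to the left. -/
theorem Recurrent.exists_isFactor_cons (hrec : Recurrent ξ) (h : IsFactor ξ W) :
    ∃ c, IsFactor ξ (c :: W) := by
  obtain ⟨i, hi, hW⟩ := hrec W h 1
  obtain ⟨j, rfl⟩ := Nat.exists_eq_add_of_le' hi
  exact ⟨ξ j, j, by rw [List.length_cons, wordAt_succ_eq_cons, ← hW]⟩

theorem StrongSpecial.leftSpecial (h : StrongSpecial ξ W) : LeftSpecial ξ W :=
  fun c => (h c true).of_append_singleton (W := c :: W)

theorem WeakSpecial.leftSpecial (hrec : Recurrent ξ) (h : WeakSpecial ξ W) :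
    LeftSpecial ξ W := by
  choose f hf using fun d => hrec.exists_isFactor_cons (h.1 d)
  have hne : f false ≠ f true := fun heq =>
    h.2 (f true) (Bool.rec (heq ▸ hf false) (hf true))
  intro c
  obtain ⟨d, rfl⟩ : ∃ d, f d = c := by
    by_cases hc : f true = c
    · exact ⟨true, hc⟩
    · exact ⟨false, by rw [Bool.eq_not.2 hne, Bool.eq_not.2 hc, Bool.not_not]⟩
  exact (hf d).of_append_singleton (W := f d :: W)

end Subst

/-- `S⁰ₙ ∪ S²ₙ ⊆ Sₙ ∩ LSₙ`: every weak or strong right special factor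
of a recurrent sequence is both right special and left special. -/
theorem statement12 (ξ : ℕ → Bool) (hrec : Recurrent ξ) (n : ℕ) :
    {W : List Bool | W.length = n ∧
        (WeakSpecial ξ W ∨ (RightSpecial ξ W ∧ StrongSpecial ξ W))}
      ⊆ {W : List Bool | W.length = n ∧ RightSpecial ξ W}
        ∩ {W : List Bool | W.length = n ∧ LeftSpecial ξ W} := by
  rintro W ⟨hn, hW | ⟨hR, hS⟩⟩
  · exact ⟨⟨hn, hW.1⟩, hn, hW.leftSpecial hrec⟩
  · exact ⟨⟨hn, hR⟩, hn, hS.leftSpecial⟩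
end
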